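/- Let Ω be a nonempty closed subset of the Riemann sphere ℂ ∪ {∞}, let (A,B) be an n×n pencil, and let f(Q,Z) = ‖(QAZ, QBZ) − T(QAZ, QBZ)‖² for (Q,Z) ∈ U(n) × U(n). A pair (Q₀,Z₀) ∈ U(n) × U(n) is a global minimizer of f over U(n) × U(n) if and only if the pencil (Q₀* T₀ Z₀*, Q₀* T₁ Z₀*), where (T₀,T₁) = T(Q₀AZ₀, Q₀BZ₀), is a global minimizer of the distance ‖(A,B) − (S,T')‖ over all pencils (S,T') in the closure of S(Ω,n). -/

import Mathlib

open Matrix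

/-- The determinant `det(A + X·B)` of the pencil `P = (A,B)`, as a polynomial in `X`. -/
noncomputable def pencilPoly {n : ℕ}
    (P : Matrix (Fin n) (Fin n) ℂ × Matrix (Fin n) (Fin n) ℂ) : Polynomial ℂ :=
  (P.1.map Polynomial.C + (Polynomial.X : Polynomial ℂ) • P.2.map Polynomial.C).det

/-- `S(Ω,n)`: the set of regular `n×n` pencils all of whose eigenvalues (finite eigenvalues
are the roots of `det(A + X·B)`; `∞` is an eigenvalue iff `det B = 0`) belong to `Ω`,
a subset of the Riemann sphere `ℂ ∪ {∞}`. -/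
def SOmega (Ω : Set (OnePoint ℂ)) (n : ℕ) :
    Set (Matrix (Fin n) (Fin n) ℂ × Matrix (Fin n) (Fin n) ℂ) :=
  {P | pencilPoly P ≠ 0 ∧
    (∀ z : ℂ, (pencilPoly P).IsRoot z → (z : OnePoint ℂ) ∈ Ω) ∧
    (P.2.det = 0 → (OnePoint.infty : OnePoint ℂ) ∈ Ω)}

/-- `S_tri(Ω,n)`: the pencils of `S(Ω,n)` with both coefficients upper triangular. -/
def Stri (Ω : Set (OnePoint ℂ)) (n : ℕ) :
    Set (Matrix (Fin n) (Fin n) ℂ × Matrix (Fin n) (Fin n) ℂ) :=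
  {P ∈ SOmega Ω n |
    (∀ i j : Fin n, j < i → P.1 i j = 0) ∧ (∀ i j : Fin n, j < i → P.2 i j = 0)}

/-- `S(Ω,1)` for `1×1` pencils, identified with pairs `(a,b) ∈ ℂ²`. -/
def SOmega1 (Ω : Set (OnePoint ℂ)) : Set (ℂ × ℂ) :=
  {p | p ≠ (0, 0) ∧ (p.2 ≠ 0 → ((-p.1 / p.2 : ℂ) : OnePoint ℂ) ∈ Ω) ∧
    (p.2 = 0 → (OnePoint.infty : OnePoint ℂ) ∈ Ω)}

/-- The norm `‖(A,B)‖ = (‖A‖_F² + ‖B‖_F²)^{1/2}` of a pencil. -/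
noncomputable def pencilNorm {n : ℕ}
    (P : Matrix (Fin n) (Fin n) ℂ × Matrix (Fin n) (Fin n) ℂ) : ℝ :=
  Real.sqrt (∑ i, ∑ j, (‖P.1 i j‖ ^ 2 + ‖P.2 i j‖ ^ 2))

/-- Euclidean distance on `ℂ²`. -/
noncomputable def distC2 (p q : ℂ × ℂ) : ℝ :=
  Real.sqrt (‖p.1 - q.1‖ ^ 2 + ‖p.2 - q.2‖ ^ 2)

/-- The operator `T` from Proposition 3.4: keep the strictly upper triangular part, project
each diagonal entry onto the closure of `S(Ω,1)` via `p_Ω`, zero out the lower part. -/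
noncomputable def Tproj {n : ℕ} (pΩ : ℂ × ℂ → ℂ × ℂ)
    (P : Matrix (Fin n) (Fin n) ℂ × Matrix (Fin n) (Fin n) ℂ) :
    Matrix (Fin n) (Fin n) ℂ × Matrix (Fin n) (Fin n) ℂ :=
  (Matrix.of fun i j =>
      if i < j then P.1 i j else if i = j then (pΩ (P.1 i i, P.2 i i)).1 else 0,
   Matrix.of fun i j =>
      if i < j then P.2 i j else if i = j then (pΩ (P.1 i i, P.2 i i)).2 else 0)

/-- A vector on which two linear maps out of a complex space become parallel. -/
theorem exists_ne_zero_parallel {E F : Type*}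
    [AddCommGroup E] [Module ℂ E] [FiniteDimensional ℂ E] [AddCommGroup F] [Module ℂ F]
    [FiniteDimensional ℂ F] [Nontrivial F] (hEF : Module.finrank ℂ E = Module.finrank ℂ F)
    (f g : F →ₗ[ℂ] E) :
    ∃ (u : F) (w : E), u ≠ 0 ∧ (∃ a : ℂ, f u = a • w) ∧ ∃ a : ℂ, g u = a • w := by
  by_cases hg : Function.Injective g
  · let e := LinearEquiv.ofInjectiveOfFinrankEq g hg hEF.symm
    obtain ⟨μ, hμ⟩ := Module.End.exists_eigenvalue (e.symm.toLinearMap ∘ₗ f)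
    obtain ⟨u, hu⟩ := hμ.exists_hasEigenvector
    refine ⟨u, g u, hu.2, ⟨μ, ?_⟩, 1, by simp⟩
    have h : e.symm (f u) = μ • u := hu.apply_eq_smul
    have h' := congrArg e h
    rw [LinearEquiv.apply_symm_apply, map_smul] at h'
    exact h'
  · rw [← LinearMap.ker_eq_bot, Submodule.eq_bot_iff] at hg
    push Not at hg
    obtain ⟨u, hu, hu0⟩ := hg
    exact ⟨u, f u, hu0, ⟨1, by simp⟩, 0, by simpa using hu⟩

theorem exists_norm_eq_one_smul_eq {E : Type*} [NormedAddCommGroup E]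
    [NormedSpace ℂ E] [Nontrivial E] (w : E) : ∃ (z : E) (a : ℂ), ‖z‖ = 1 ∧ w = a • z := by
  by_cases hw : w = 0
  · obtain ⟨x, hx⟩ := exists_ne (0 : E)
    exact ⟨((‖x‖⁻¹ : ℝ) : ℂ) • x, 0, by simp [norm_smul, hx], by simp [hw]⟩
  · have hw' : (‖w‖ : ℂ) ≠ 0 := by simpa using hw
    refine ⟨((‖w‖⁻¹ : ℝ) : ℂ) • w, ‖w‖, by simp [norm_smul, hw], ?_⟩
    rw [smul_smul, Complex.ofReal_inv, mul_inv_cancel₀ hw', one_smul]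

theorem orthonormal_snoc {E : Type*} [NormedAddCommGroup E] [InnerProductSpace ℂ E] {n : ℕ}
    {z : E} (hz : ‖z‖ = 1) {b : Fin n → (ℂ ∙ z)ᗮ} (hb : Orthonormal ℂ b) :
    Orthonormal ℂ (Fin.snoc (fun i => (b i : E)) z : Fin (n + 1) → E) := by
  have hzb : ∀ i, inner ℂ z (b i : E) = 0 := fun i =>
    Submodule.mem_orthogonal_singleton_iff_inner_right.1 (b i).2
  have hbz : ∀ i, inner ℂ (b i : E) z = 0 := fun i =>
    Submodule.mem_orthogonal_singleton_iff_inner_left.1 (b i).2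
  rw [orthonormal_iff_ite] at hb ⊢
  intro i j
  induction i using Fin.lastCases with
  | last =>
    induction j using Fin.lastCases with
    | last => simp [inner_self_eq_norm_sq_to_K, hz]
    | cast j => simp [hzb, (Fin.castSucc_lt_last j).ne']
  | cast i =>
    induction j using Fin.lastCases with
    | last => simp [hbz, (Fin.castSucc_lt_last i).ne]
    | cast j => simpa using hb i j

/-- Generalized Schur decomposition: two linear maps between complex inner product spaces of
the same dimension are simultaneously upper triangular in suitable orthonormal families. -/
theorem exists_orthonormal_upperTriangular {n : ℕ} {E F : Type*}
    [NormedAddCommGroup E] [InnerProductSpace ℂ E] [FiniteDimensional ℂ E]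
    [NormedAddCommGroup F] [InnerProductSpace ℂ F] [FiniteDimensional ℂ F]
    (hE : Module.finrank ℂ E = n) (hF : Module.finrank ℂ F = n) (f g : E →ₗ[ℂ] F) :
    ∃ (b : Fin n → E) (c : Fin n → F), Orthonormal ℂ b ∧ Orthonormal ℂ c ∧
      ∀ i j, j < i → inner ℂ (c i) (f (b j)) = 0 ∧ inner ℂ (c i) (g (b j)) = 0 := by
  induction n generalizing E F with
  | zero => exact ⟨Fin.elim0, Fin.elim0, by simp, by simp, fun i => i.elim0⟩
  | succ n ih =>
    have : Nontrivial E := Module.nontrivial_of_finrank_pos (R := ℂ) (by omega)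
    have : Nontrivial F := Module.nontrivial_of_finrank_pos (R := ℂ) (by omega)
    obtain ⟨u', w, hu', ⟨p, hp⟩, q, hq⟩ :=
      exists_ne_zero_parallel (hE.trans hF.symm) f.adjoint g.adjoint
    obtain ⟨z, a, hz, rfl⟩ := exists_norm_eq_one_smul_eq w
    obtain ⟨u, s, hu, rfl⟩ := exists_norm_eq_one_smul_eq u'
    have hs : s ≠ 0 := fun h => hu' (by simp [h])
    have hz0 : z ≠ 0 := fun h => by simp [h] at hz
    have hu0 : u ≠ 0 := fun h => by simp [h] at hu
    have key : ∀ (h : E →ₗ[ℂ] F) (r : ℂ), h.adjoint (s • u) = r • a • z →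
        ∀ x ∈ (ℂ ∙ z)ᗮ, h x ∈ (ℂ ∙ u)ᗮ := by
      intro h r hr x hx
      rw [Submodule.mem_orthogonal_singleton_iff_inner_right] at hx ⊢
      have h1 : inner ℂ (s • u) (h x) = 0 := by
        rw [← LinearMap.adjoint_inner_left, hr, inner_smul_left, inner_smul_left, hx]
        simp
      simpa [inner_smul_left, hs] using h1
    have : Fact (Module.finrank ℂ E = n + 1) := ⟨hE⟩
    have : Fact (Module.finrank ℂ F = n + 1) := ⟨hF⟩
    obtain ⟨b, c, hb, hc, h⟩ := ih (Submodule.finrank_orthogonal_span_singleton hz0)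
      (Submodule.finrank_orthogonal_span_singleton hu0)
      (f.restrict (key f p hp)) (g.restrict (key g q hq))
    refine ⟨_, _, orthonormal_snoc hz hb, orthonormal_snoc hu hc, fun i j hij => ?_⟩
    have hj : j ≠ Fin.last n := (hij.trans_le (Fin.le_last i)).ne
    obtain ⟨j, rfl⟩ := Fin.exists_castSucc_eq.2 hj
    induction i using Fin.lastCases with
    | last =>
      simp only [Fin.snoc_last, Fin.snoc_castSucc]
      exact ⟨Submodule.mem_orthogonal_singleton_iff_inner_right.1 (key f p hp _ (b j).2),
        Submodule.mem_orthogonal_singleton_iff_inner_right.1 (key g q hq _ (b j).2)⟩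
    | cast i =>
      simp only [Fin.snoc_castSucc]
      exact h i j (Fin.castSucc_lt_castSucc_iff.1 hij)

section Pencil

variable {n : ℕ} {Ω : Set (OnePoint ℂ)}

theorem exists_unitary_upperTriangular
    (P : Matrix (Fin n) (Fin n) ℂ × Matrix (Fin n) (Fin n) ℂ) :
    ∃ Q ∈ unitaryGroup (Fin n) ℂ, ∃ Z ∈ unitaryGroup (Fin n) ℂ,
      (∀ i j, j < i → (Q * P.1 * Z) i j = 0) ∧ ∀ i j, j < i → (Q * P.2 * Z) i j = 0 := by
  obtain ⟨b, c, hb, hc, h⟩ := exists_orthonormal_upperTriangular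
    (E := EuclideanSpace ℂ (Fin n)) (F := EuclideanSpace ℂ (Fin n)) (n := n) (by simp) (by simp)
    (toLpLin 2 2 P.1) (toLpLin 2 2 P.2)
  have entry : ∀ (M : Matrix (Fin n) (Fin n) ℂ) i j,
      ((of fun i k => star (c i k)) * M * (of fun k j => b j k)) i j =
        inner ℂ (c i) (toLpLin 2 2 M (b j)) := by
    intro M i j
    rw [Matrix.mul_assoc, Matrix.mul_apply, PiLp.inner_apply]
    refine Finset.sum_congr rfl fun k _ => ?_
    rw [RCLike.inner_apply, mul_comm]
    rfl
  rw [orthonormal_iff_ite] at hb hc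
  refine ⟨of fun i k => star (c i k), ?_, of fun k j => b j k, ?_, ?_, ?_⟩
  · rw [mem_unitaryGroup_iff]
    ext i j
    rw [Matrix.mul_apply, Matrix.one_apply, ← hc i j, PiLp.inner_apply]
    exact Finset.sum_congr rfl fun k _ => by simp [star_apply, mul_comm]
  · rw [mem_unitaryGroup_iff']
    ext i j
    rw [Matrix.mul_apply, Matrix.one_apply, ← hb i j, PiLp.inner_apply]
    exact Finset.sum_congr rfl fun k _ => by simp [star_apply, mul_comm]
  · exact fun i j hij => (entry P.1 i j).trans (h i j hij).1
  · exact fun i j hij => (entry P.2 i j).trans (h i j hij).2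

theorem sum_norm_sq_eq_re_trace (M : Matrix (Fin n) (Fin n) ℂ) :
    ∑ i, ∑ j, ‖M i j‖ ^ 2 = (Mᴴ * M).trace.re := by
  rw [Finset.sum_comm, trace, Complex.re_sum]
  refine Finset.sum_congr rfl fun j _ => ?_
  rw [diag_apply, Matrix.mul_apply, Complex.re_sum]
  refine Finset.sum_congr rfl fun i _ => ?_
  rw [conjTranspose_apply, Complex.star_def, ← Complex.normSq_eq_conj_mul_self,
    Complex.ofReal_re, Complex.normSq_eq_norm_sq]

theorem sum_norm_sq_unitary_mul_mul {Q Z : Matrix (Fin n) (Fin n) ℂ}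
    (hQ : Q ∈ unitaryGroup (Fin n) ℂ) (hZ : Z ∈ unitaryGroup (Fin n) ℂ)
    (M : Matrix (Fin n) (Fin n) ℂ) :
    ∑ i, ∑ j, ‖(Q * M * Z) i j‖ ^ 2 = ∑ i, ∑ j, ‖M i j‖ ^ 2 := by
  have hQ' : Qᴴ * Q = 1 := mem_unitaryGroup_iff'.1 hQ
  have hZ' : Z * Zᴴ = 1 := mem_unitaryGroup_iff.1 hZ
  have h : (Q * M * Z)ᴴ * (Q * M * Z) = Zᴴ * (Mᴴ * (Qᴴ * Q) * M * Z) := by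
    simp only [conjTranspose_mul, Matrix.mul_assoc]
  rw [sum_norm_sq_eq_re_trace, sum_norm_sq_eq_re_trace, h, hQ', trace_mul_comm, Matrix.mul_assoc,
    hZ', Matrix.mul_one, Matrix.mul_one]

theorem pencilNorm_unitary_mul_mul {Q Z : Matrix (Fin n) (Fin n) ℂ}
    (hQ : Q ∈ unitaryGroup (Fin n) ℂ) (hZ : Z ∈ unitaryGroup (Fin n) ℂ)
    (P : Matrix (Fin n) (Fin n) ℂ × Matrix (Fin n) (Fin n) ℂ) :
    pencilNorm (Q * P.1 * Z, Q * P.2 * Z) = pencilNorm P := by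
  simp only [pencilNorm, Finset.sum_add_distrib, sum_norm_sq_unitary_mul_mul hQ hZ]

theorem pencilNorm_sub_unitary_mul_mul {Q Z : Matrix (Fin n) (Fin n) ℂ}
    (hQ : Q ∈ unitaryGroup (Fin n) ℂ) (hZ : Z ∈ unitaryGroup (Fin n) ℂ)
    (P R : Matrix (Fin n) (Fin n) ℂ × Matrix (Fin n) (Fin n) ℂ) :
    pencilNorm ((Q * P.1 * Z, Q * P.2 * Z) - (Q * R.1 * Z, Q * R.2 * Z)) = pencilNorm (P - R) := by
  rw [← pencilNorm_unitary_mul_mul hQ hZ (P - R)]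
  simp [Matrix.mul_sub, Matrix.sub_mul]

theorem continuous_pencilNorm : Continuous (pencilNorm (n := n)) := by
  unfold pencilNorm
  fun_prop

theorem pencilPoly_mul_mul (Q Z : Matrix (Fin n) (Fin n) ℂ)
    (P : Matrix (Fin n) (Fin n) ℂ × Matrix (Fin n) (Fin n) ℂ) :
    pencilPoly (Q * P.1 * Z, Q * P.2 * Z) =
      Polynomial.C Q.det * pencilPoly P * Polynomial.C Z.det := by
  have hmap : ∀ M : Matrix (Fin n) (Fin n) ℂ,
      Polynomial.C M.det = (M.map Polynomial.C).det := fun M => RingHom.map_det _ M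
  rw [hmap, hmap, pencilPoly, pencilPoly, ← det_mul, ← det_mul]
  simp only [Matrix.map_mul, Matrix.mul_add, Matrix.add_mul, Matrix.mul_smul, Matrix.smul_mul]

theorem det_ne_zero_of_mem_unitaryGroup {Q : Matrix (Fin n) (Fin n) ℂ}
    (hQ : Q ∈ unitaryGroup (Fin n) ℂ) : Q.det ≠ 0 := by
  intro h
  have := congrArg det (mem_unitaryGroup_iff.1 hQ)
  simp [h] at this

theorem SOmega_mul_mul {Q Z : Matrix (Fin n) (Fin n) ℂ}
    (hQ : Q ∈ unitaryGroup (Fin n) ℂ) (hZ : Z ∈ unitaryGroup (Fin n) ℂ)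
    {P : Matrix (Fin n) (Fin n) ℂ × Matrix (Fin n) (Fin n) ℂ} (hP : P ∈ SOmega Ω n) :
    (Q * P.1 * Z, Q * P.2 * Z) ∈ SOmega Ω n := by
  have hQd := det_ne_zero_of_mem_unitaryGroup hQ
  have hZd := det_ne_zero_of_mem_unitaryGroup hZ
  obtain ⟨h0, hr, hinf⟩ := hP
  refine ⟨?_, fun z hz => hr z ?_, fun h => hinf ?_⟩
  · rw [pencilPoly_mul_mul]
    simp [h0, hQd, hZd]
  · rw [pencilPoly_mul_mul] at hz
    simpa [Polynomial.IsRoot, hQd, hZd] using hz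
  · simpa [hQd, hZd] using h

theorem pencilPoly_of_upperTriangular
    {P : Matrix (Fin n) (Fin n) ℂ × Matrix (Fin n) (Fin n) ℂ}
    (h1 : ∀ i j, j < i → P.1 i j = 0) (h2 : ∀ i j, j < i → P.2 i j = 0) :
    pencilPoly P =
      ∏ i, (Polynomial.C (P.1 i i) + Polynomial.X * Polynomial.C (P.2 i i)) := by
  rw [pencilPoly, det_of_isUpperTriangular]
  · simp
  · intro i j hij
    simp [h1 i j hij, h2 i j hij]

theorem mem_SOmega_iff_of_upperTriangular
    {P : Matrix (Fin n) (Fin n) ℂ × Matrix (Fin n) (Fin n) ℂ}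
    (h1 : ∀ i j, j < i → P.1 i j = 0) (h2 : ∀ i j, j < i → P.2 i j = 0) :
    P ∈ SOmega Ω n ↔ ∀ i, (P.1 i i, P.2 i i) ∈ SOmega1 Ω := by
  have hp := pencilPoly_of_upperTriangular h1 h2
  have hd : P.2.det = ∏ i, P.2 i i := det_of_isUpperTriangular fun i j hij => h2 i j hij
  have hroot : ∀ z, (pencilPoly P).IsRoot z ↔ ∃ i, P.1 i i + z * P.2 i i = 0 := by
    intro z
    simp [hp, Polynomial.IsRoot, Polynomial.eval_prod, Finset.prod_eq_zero_iff, mul_comm z]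
  constructor
  · rintro ⟨h0, hr, hinf⟩ i
    refine ⟨fun h => h0 ?_, fun hb => hr _ ((hroot _).2 ⟨i, ?_⟩), fun hb => hinf ?_⟩
    · rw [hp]
      refine Finset.prod_eq_zero (Finset.mem_univ i) ?_
      simp [(Prod.mk.inj h).1, (Prod.mk.inj h).2]
    · simp only at hb ⊢
      field_simp
      ring
    · rw [hd]
      exact Finset.prod_eq_zero (Finset.mem_univ i) hb
  · intro h
    refine ⟨?_, fun z hz => ?_, fun hz => ?_⟩
    · rw [hp, Finset.prod_ne_zero_iff]
      intro i _ hi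
      refine (h i).1 (Prod.ext ?_ ?_)
      · simpa using congrArg (Polynomial.coeff · 0) hi
      · simpa [Polynomial.coeff_C] using congrArg (Polynomial.coeff · 1) hi
    · obtain ⟨i, hi⟩ := (hroot z).1 hz
      have hb : P.2 i i ≠ 0 := by
        intro hb
        refine (h i).1 (Prod.ext ?_ hb)
        simpa [hb] using hi
      have hz' : -P.1 i i / P.2 i i = z := by
        rw [div_eq_iff hb]
        linear_combination -hi
      simpa only [hz'] using (h i).2.1 hb
    · rw [hd, Finset.prod_eq_zero_iff] at hz
      obtain ⟨i, _, hi⟩ := hz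
      exact (h i).2.2 hi

theorem mem_closure_SOmega_of_upperTriangular
    {P : Matrix (Fin n) (Fin n) ℂ × Matrix (Fin n) (Fin n) ℂ}
    (h1 : ∀ i j, j < i → P.1 i j = 0) (h2 : ∀ i j, j < i → P.2 i j = 0)
    (hP : ∀ i, (P.1 i i, P.2 i i) ∈ closure (SOmega1 Ω)) : P ∈ closure (SOmega Ω n) := by
  let Φ : (Fin n → ℂ × ℂ) → Matrix (Fin n) (Fin n) ℂ × Matrix (Fin n) (Fin n) ℂ := fun d =>
    (of fun i j => if i = j then (d i).1 else P.1 i j,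
      of fun i j => if i = j then (d i).2 else P.2 i j)
  have hΦ : Continuous Φ := by
    refine Continuous.prodMk ?_ ?_ <;>
    · refine continuous_matrix fun i j => ?_
      by_cases hij : i = j <;> simp only [of_apply, hij, if_true, if_false] <;> fun_prop
  have hmaps : Set.MapsTo Φ (Set.univ.pi fun _ => SOmega1 Ω) (SOmega Ω n) := by
    intro d hd
    refine (mem_SOmega_iff_of_upperTriangular ?_ ?_).2 fun i => ?_
    · intro i j hij
      simp [Φ, hij.ne', h1 i j hij]
    · intro i j hij
      simp [Φ, hij.ne', h2 i j hij]
    · simpa [Φ] using hd i (Set.mem_univ i)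
  have hdiag : (fun i => (P.1 i i, P.2 i i)) ∈ closure (Set.univ.pi fun _ => SOmega1 Ω) := by
    rw [closure_pi_set]
    exact fun i _ => hP i
  have hΦP : Φ (fun i => (P.1 i i, P.2 i i)) = P := by
    refine Prod.ext ?_ ?_ <;> ext i j <;> by_cases hij : i = j <;> simp [Φ, hij]
  exact hΦP ▸ map_mem_closure hΦ hdiag hmaps

theorem mul_mul_mem_closure_SOmega {Q Z : Matrix (Fin n) (Fin n) ℂ}
    (hQ : Q ∈ unitaryGroup (Fin n) ℂ) (hZ : Z ∈ unitaryGroup (Fin n) ℂ)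
    {P : Matrix (Fin n) (Fin n) ℂ × Matrix (Fin n) (Fin n) ℂ} (hP : P ∈ closure (SOmega Ω n)) :
    (Q * P.1 * Z, Q * P.2 * Z) ∈ closure (SOmega Ω n) := by
  have hc : Continuous fun P : Matrix (Fin n) (Fin n) ℂ × Matrix (Fin n) (Fin n) ℂ =>
      (Q * P.1 * Z, Q * P.2 * Z) := by fun_prop
  exact map_mem_closure (f := fun P => (Q * P.1 * Z, Q * P.2 * Z)) hc hP
    fun _ hR => SOmega_mul_mul hQ hZ hR

theorem Tproj_mem_closure_SOmega {pΩ : ℂ × ℂ → ℂ × ℂ}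
    (hmem : ∀ p : ℂ × ℂ, pΩ p ∈ closure (SOmega1 Ω))
    (P : Matrix (Fin n) (Fin n) ℂ × Matrix (Fin n) (Fin n) ℂ) :
    Tproj pΩ P ∈ closure (SOmega Ω n) := by
  refine mem_closure_SOmega_of_upperTriangular ?_ ?_ fun i => ?_
  · intro i j hij
    simp [Tproj, hij.not_gt, hij.ne']
  · intro i j hij
    simp [Tproj, hij.not_gt, hij.ne']
  · simpa [Tproj] using hmem _

theorem pencilNorm_sub_Tproj_le {pΩ : ℂ × ℂ → ℂ × ℂ}
    (hdist : ∀ p : ℂ × ℂ, ∀ q ∈ closure (SOmega1 Ω), distC2 p (pΩ p) ≤ distC2 p q)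
    (P : Matrix (Fin n) (Fin n) ℂ × Matrix (Fin n) (Fin n) ℂ)
    {R : Matrix (Fin n) (Fin n) ℂ × Matrix (Fin n) (Fin n) ℂ} (hR : R ∈ Stri Ω n) :
    pencilNorm (P - Tproj pΩ P) ≤ pencilNorm (P - R) := by
  obtain ⟨hS, h1, h2⟩ := hR
  refine Real.sqrt_le_sqrt (Finset.sum_le_sum fun i _ => Finset.sum_le_sum fun j _ => ?_)
  rcases lt_trichotomy i j with hij | rfl | hij
  · have h0 : ‖(P - Tproj pΩ P).1 i j‖ ^ 2 + ‖(P - Tproj pΩ P).2 i j‖ ^ 2 = 0 := by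
      simp [Tproj, hij]
    rw [h0]
    positivity
  · have h := hdist (P.1 i i, P.2 i i) (R.1 i i, R.2 i i)
      (subset_closure ((mem_SOmega_iff_of_upperTriangular h1 h2).1 hS i))
    rw [distC2, distC2, Real.sqrt_le_sqrt_iff (by positivity)] at h
    simpa [Tproj] using h
  · simp [Tproj, hij.not_gt, hij.ne', h1 i j hij, h2 i j hij]

end Pencil

/-- `(Q₀,Z₀)` is a global minimizer of `f(Q,Z) = ‖(QAZ,QBZ) − T(QAZ,QBZ)‖²`
over `U(n) × U(n)` iff the pencil `(Q₀* T₀ Z₀*, Q₀* T₁ Z₀*)`, with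
`(T₀,T₁) = T(Q₀AZ₀, Q₀BZ₀)`, is a global minimizer of `‖(A,B) − ·‖` over the closure
of `S(Ω,n)`. -/
theorem global_minimizer_iff {n : ℕ} (Ω : Set (OnePoint ℂ))
    (hclosed : IsClosed Ω) (hne : Ω.Nonempty)
    (pΩ : ℂ × ℂ → ℂ × ℂ)
    (hmem : ∀ p : ℂ × ℂ, pΩ p ∈ closure (SOmega1 Ω))
    (hdist : ∀ p : ℂ × ℂ, ∀ q ∈ closure (SOmega1 Ω), distC2 p (pΩ p) ≤ distC2 p q)
    (A B Q₀ Z₀ : Matrix (Fin n) (Fin n) ℂ)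
    (hQ₀ : Q₀ ∈ Matrix.unitaryGroup (Fin n) ℂ) (hZ₀ : Z₀ ∈ Matrix.unitaryGroup (Fin n) ℂ) :
    (∀ Q ∈ Matrix.unitaryGroup (Fin n) ℂ, ∀ Z ∈ Matrix.unitaryGroup (Fin n) ℂ,
        pencilNorm ((Q₀ * A * Z₀, Q₀ * B * Z₀) - Tproj pΩ (Q₀ * A * Z₀, Q₀ * B * Z₀)) ^ 2 ≤
        pencilNorm ((Q * A * Z, Q * B * Z) - Tproj pΩ (Q * A * Z, Q * B * Z)) ^ 2) ↔
    ((Q₀ᴴ * (Tproj pΩ (Q₀ * A * Z₀, Q₀ * B * Z₀)).1 * Z₀ᴴ,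
      Q₀ᴴ * (Tproj pΩ (Q₀ * A * Z₀, Q₀ * B * Z₀)).2 * Z₀ᴴ) ∈ closure (SOmega Ω n) ∧
     ∀ P ∈ closure (SOmega Ω n),
      pencilNorm ((A, B) - (Q₀ᴴ * (Tproj pΩ (Q₀ * A * Z₀, Q₀ * B * Z₀)).1 * Z₀ᴴ,
        Q₀ᴴ * (Tproj pΩ (Q₀ * A * Z₀, Q₀ * B * Z₀)).2 * Z₀ᴴ)) ≤
      pencilNorm ((A, B) - P)) := by
  have cancel : ∀ {Q Z : Matrix (Fin n) (Fin n) ℂ}, Q ∈ unitaryGroup (Fin n) ℂ →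
      Z ∈ unitaryGroup (Fin n) ℂ → ∀ M, Q * (Qᴴ * M * Zᴴ) * Z = M := by
    intro Q Z hQ hZ M
    have hQ' : Q * Qᴴ = 1 := mem_unitaryGroup_iff.1 hQ
    have hZ' : Zᴴ * Z = 1 := mem_unitaryGroup_iff'.1 hZ
    rw [Matrix.mul_assoc, Matrix.mul_assoc, hZ', Matrix.mul_one, ← Matrix.mul_assoc, hQ',
      Matrix.one_mul]
  have dist_eq : ∀ {Q Z : Matrix (Fin n) (Fin n) ℂ}, Q ∈ unitaryGroup (Fin n) ℂ →
      Z ∈ unitaryGroup (Fin n) ℂ → ∀ R : Matrix (Fin n) (Fin n) ℂ × Matrix (Fin n) (Fin n) ℂ,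
      pencilNorm ((A, B) - (Qᴴ * R.1 * Zᴴ, Qᴴ * R.2 * Zᴴ)) =
        pencilNorm ((Q * A * Z, Q * B * Z) - R) := by
    intro Q Z hQ hZ R
    rw [← pencilNorm_sub_unitary_mul_mul hQ hZ]
    simp only [cancel hQ hZ]
  have mem : ∀ {Q Z : Matrix (Fin n) (Fin n) ℂ}, Q ∈ unitaryGroup (Fin n) ℂ →
      Z ∈ unitaryGroup (Fin n) ℂ →
      (Qᴴ * (Tproj pΩ (Q * A * Z, Q * B * Z)).1 * Zᴴ,
        Qᴴ * (Tproj pΩ (Q * A * Z, Q * B * Z)).2 * Zᴴ) ∈ closure (SOmega Ω n) :=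
    fun hQ hZ => mul_mul_mem_closure_SOmega (Unitary.star_mem hQ) (Unitary.star_mem hZ)
      (Tproj_mem_closure_SOmega hmem _)
  constructor
  · intro h
    refine ⟨mem hQ₀ hZ₀, fun P hP => ?_⟩
    rw [dist_eq hQ₀ hZ₀]
    refine closure_minimal (t := {P | _ ≤ pencilNorm ((A, B) - P)}) (fun R hR => ?_)
      (isClosed_le continuous_const (continuous_pencilNorm.comp (by fun_prop))) hP
    obtain ⟨Q, hQ, Z, hZ, h1, h2⟩ := exists_unitary_upperTriangular R
    refine (pow_le_pow_iff_left₀ (Real.sqrt_nonneg _) (Real.sqrt_nonneg _) two_ne_zero).1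
      (h Q hQ Z hZ) |>.trans ?_
    rw [← pencilNorm_sub_unitary_mul_mul hQ hZ]
    exact pencilNorm_sub_Tproj_le hdist _ ⟨SOmega_mul_mul hQ hZ hR, h1, h2⟩
  · rintro ⟨-, h⟩ Q hQ Z hZ
    have hle := h _ (mem hQ hZ)
    rw [dist_eq hQ₀ hZ₀, dist_eq hQ hZ] at hle
    exact pow_le_pow_left₀ (Real.sqrt_nonneg _) hle 2
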